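/- Let X be a set and h, c, φ : X → ℝ be functions. For c̄ ∈ ℝ define the surrogate feasible set S(c̄) = { x ∈ X : h(x) ≤ c̄² + 2·c̄·(c(x) − c̄) }. Let (x_t)_{t ≥ 0} be a sequence in X such that h(x₀) ≤ c(x₀)², and for every t: x_{t+1} ∈ S(c(x_t)) and φ(x_{t+1}) ≤ φ(y) for all y ∈ S(c(x_t)). Then: (i) h(x_t) ≤ c(x_t)² for every t (all iterates are feasible for the original problem); (ii) the sequence (φ(x_t)) is non-increasing; and (iii) if there exists m ∈ ℝ with m ≤ φ(x) for every x satisfying h(x) ≤ c(x)², then the sequence (φ(x_t)) converges. -/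

import Mathlib

/-- Convergence of the SCA iteration (Proposition 1): with surrogate feasible sets
`S(c̄) = {x | h x ≤ c̄² + 2 c̄ (c x - c̄)}`, if `x₀` is feasible for the original
constraint `h x ≤ (c x)²`, and each `x_{t+1}` lies in `S (c (x t))` and minimizes `φ`
over `S (c (x t))`, then (i) every iterate satisfies the original constraint,
(ii) `φ (x t)` is non-increasing, and (iii) if `φ` is bounded below on the original
feasible set, then `φ (x t)` converges. -/
theorem sca_iteration_converges
    {X : Type*} (h c φ : X → ℝ)
    (S : ℝ → Set X)
    (hS : ∀ cbar, S cbar = {x : X | h x ≤ cbar ^ 2 + 2 * cbar * (c x - cbar)})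
    (x : ℕ → X)
    (h0 : h (x 0) ≤ (c (x 0)) ^ 2)
    (hmem : ∀ t, x (t + 1) ∈ S (c (x t)))
    (hopt : ∀ t, ∀ y ∈ S (c (x t)), φ (x (t + 1)) ≤ φ y) :
    (∀ t, h (x t) ≤ (c (x t)) ^ 2) ∧
    (∀ t, φ (x (t + 1)) ≤ φ (x t)) ∧
    ((∃ m : ℝ, ∀ y : X, h y ≤ (c y) ^ 2 → m ≤ φ y) →
      ∃ l : ℝ, Filter.Tendsto (fun t => φ (x t)) Filter.atTop (nhds l)) := by
  have feasible : ∀ t, h (x t) ≤ (c (x t)) ^ 2 := by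
    intro t
    cases t with
    | zero => exact h0
    | succ t =>
      have ht := hmem t
      rw [hS, Set.mem_ofPred_eq] at ht
      linarith [sq_nonneg (c (x (t + 1)) - c (x t))]
  have descent : ∀ t, φ (x (t + 1)) ≤ φ (x t) := by
    intro t
    apply hopt t
    rw [hS, Set.mem_ofPred_eq]
    linarith [feasible t]
  refine ⟨feasible, descent, ?_⟩
  rintro ⟨m, hm⟩
  refine ⟨_, tendsto_atTop_ciInf (antitone_nat_of_succ_le descent) ⟨m, ?_⟩⟩
  rintro _ ⟨t, rfl⟩
  exact hm _ (feasible t)
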